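/- Let μ ∈ ℝ, σ > 0, p ∈ (0,1), α ≠ 0, and let f be the GAL(μ,σ,p,α) density. Then for every y ∈ ℝ, with y* = (y−μ)/σ, ∫_{−∞}^y f(v) dv = ( 1 − 2Φ(−y*/|α|) − (2p(1−p)/p⁻)·exp(−y* p⁻ + α²(p⁻)²/2)·[Φ(y*/α − α p⁻) − Φ(−α p⁻)] )·1{y*/α > 0} + 1{α < 0} − (2p(1−p)/p⁺)·exp(−y* p⁺ + α²(p⁺)²/2)·Φ( α p⁺ − (y*/α)·1{y*/α > 0} ). -/

import Mathlib

open MeasureTheory Real Set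

/-- Standard normal CDF. -/
noncomputable def Phi (x : ℝ) : ℝ :=
  ∫ t in Set.Iic x, (Real.sqrt (2 * Real.pi))⁻¹ * Real.exp (-t ^ 2 / 2)

/-- The GAL(μ,σ,p,α) probability density function. -/
noncomputable def galPdf (μ σ p α y : ℝ) : ℝ :=
  let ys := (y - μ) / σ
  let pp := p - (if 0 < α then 1 else 0)
  let pm := p - (if α < 0 then 1 else 0)
  (2 * p * (1 - p) / σ) *
    ((Phi (ys / α - α * pm) - Phi (-(α * pm))) *
        Real.exp (-(ys * pm) + (α * pm) ^ 2 / 2) *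
        (if 0 < ys / α then 1 else 0) +
      Phi (α * pp - ys / α * (if 0 < ys / α then 1 else 0)) *
        Real.exp (-(ys * pp) + (α * pp) ^ 2 / 2))

open Filter Topology ProbabilityTheory

/-- Fundamental theorem of calculus on a left half-line, for a continuous nonnegative derivative. -/
theorem integral_Iic_of_hasDerivAt_of_continuous_of_nonneg {f f' : ℝ → ℝ} {m : ℝ}
    (hderiv : ∀ x, HasDerivAt f (f' x) x) (hcont : Continuous f') (hpos : ∀ x, 0 ≤ f' x)
    (hf : Tendsto f atBot (𝓝 m)) (a : ℝ) : ∫ x in Iic a, f' x = f a - m := by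
  refine integral_Iic_of_hasDerivAt_of_tendsto' (fun x _ => hderiv x) ?_ hf
  refine integrableOn_Iic_of_intervalIntegral_norm_tendsto (f a - m) a
    (fun i => (hcont.integrableOn_Icc (a := i) (b := a)).mono_set Ioc_subset_Icc_self) tendsto_id ?_
  have h (i : ℝ) : ∫ x in i..a, ‖f' x‖ = f a - f i := by
    simp_rw [Real.norm_of_nonneg (hpos _)]
    exact intervalIntegral.integral_eq_sub_of_hasDerivAt (fun x _ => hderiv x)
      (hcont.intervalIntegrable _ _)
  simpa only [id, h] using hf.const_sub (f a)

/-- Standard normal density. -/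
noncomputable def stdNormalPdf (t : ℝ) : ℝ := (√(2 * π))⁻¹ * rexp (-t ^ 2 / 2)

theorem stdNormalPdf_eq_gaussianPDFReal : stdNormalPdf = gaussianPDFReal 0 1 := by
  ext t
  simp [stdNormalPdf, gaussianPDFReal]

theorem continuous_stdNormalPdf : Continuous stdNormalPdf := by
  unfold stdNormalPdf
  fun_prop

theorem stdNormalPdf_neg (t : ℝ) : stdNormalPdf (-t) = stdNormalPdf t := by
  simp [stdNormalPdf]

theorem integrable_stdNormalPdf : Integrable stdNormalPdf := by
  rw [stdNormalPdf_eq_gaussianPDFReal]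
  exact integrable_gaussianPDFReal 0 1

theorem Phi_eq_integral_stdNormalPdf (x : ℝ) : Phi x = ∫ t in Iic x, stdNormalPdf t := rfl

theorem Phi_eq_cdf : Phi = cdf (gaussianReal 0 1) := by
  ext x
  rw [cdf_eq_real, measureReal_def, gaussianReal_apply_eq_integral 0 one_ne_zero,
    ENNReal.toReal_ofReal (integral_nonneg fun t => gaussianPDFReal_nonneg 0 1 t),
    ← stdNormalPdf_eq_gaussianPDFReal, Phi_eq_integral_stdNormalPdf]

theorem monotone_Phi : Monotone Phi := Phi_eq_cdf ▸ monotone_cdf _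

theorem Phi_nonneg (x : ℝ) : 0 ≤ Phi x := Phi_eq_cdf ▸ cdf_nonneg _ x

theorem tendsto_Phi_atTop : Tendsto Phi atTop (𝓝 1) := Phi_eq_cdf ▸ tendsto_cdf_atTop _

theorem hasDerivAt_Phi (x : ℝ) : HasDerivAt Phi (stdNormalPdf x) x := by
  have h : Phi = fun u => Phi 0 + ∫ t in (0 : ℝ)..u, stdNormalPdf t := by
    ext u
    rw [← intervalIntegral.integral_Iic_sub_Iic integrable_stdNormalPdf.integrableOn
      integrable_stdNormalPdf.integrableOn, Phi_eq_integral_stdNormalPdf,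
      Phi_eq_integral_stdNormalPdf]
    ring
  rw [h]
  exact (intervalIntegral.integral_hasDerivAt_right
    (continuous_stdNormalPdf.intervalIntegrable _ _)
    continuous_stdNormalPdf.aestronglyMeasurable.stronglyMeasurableAtFilter
    continuous_stdNormalPdf.continuousAt).const_add _

theorem continuous_Phi : Continuous Phi :=
  continuous_iff_continuousAt.2 fun x => (hasDerivAt_Phi x).continuousAt

theorem Phi_zero : Phi 0 = 1 / 2 := by
  have h1 : ∫ t in Iic (0 : ℝ), stdNormalPdf t = ∫ t in Ioi (0 : ℝ), stdNormalPdf t := by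
    simpa [stdNormalPdf_neg] using integral_comp_neg_Iic 0 stdNormalPdf
  have h2 := intervalIntegral.integral_Iic_add_Ioi (b := (0 : ℝ))
    integrable_stdNormalPdf.integrableOn integrable_stdNormalPdf.integrableOn
  rw [stdNormalPdf_eq_gaussianPDFReal, integral_gaussianPDFReal_eq_one 0 one_ne_zero,
    ← stdNormalPdf_eq_gaussianPDFReal, ← h1] at h2
  rw [Phi_eq_integral_stdNormalPdf]
  linarith

/-- Chernoff bound for the lower tail of the standard normal distribution. -/
theorem Phi_le_exp {u : ℝ} (hu : u ≤ 0) (x : ℝ) : Phi x ≤ rexp (-(u * x) + u ^ 2 / 2) := by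
  have h := measure_le_le_exp_mul_mgf (μ := gaussianReal 0 1) (X := id) x hu
    (integrable_exp_mul_gaussianReal u)
  rw [mgf_id_gaussianReal, ← Real.exp_add] at h
  rw [Phi_eq_cdf, cdf_eq_real]
  refine h.trans_eq ?_
  simp

/-- The exponential factor `exp (-t r + (α r)² / 2)` of the GAL density. -/
noncomputable def galExp (α r t : ℝ) : ℝ := rexp (-(t * r) + (α * r) ^ 2 / 2)

theorem continuous_galExp (α r : ℝ) : Continuous (galExp α r) := by
  unfold galExp
  fun_prop

theorem hasDerivAt_galExp (α r t : ℝ) : HasDerivAt (galExp α r) (-r * galExp α r t) t := by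
  have h : HasDerivAt (fun t : ℝ => -(t * r) + (α * r) ^ 2 / 2) (-(1 * r)) t :=
    (((hasDerivAt_id t).mul_const r).neg).add_const _
  refine h.exp.congr_deriv ?_
  simp only [galExp]
  ring

theorem tendsto_galExp_atBot (α : ℝ) {r : ℝ} (hr : r < 0) :
    Tendsto (galExp α r) atBot (𝓝 0) := by
  refine Real.tendsto_exp_atBot.comp (tendsto_atBot_add_const_right _ _ ?_)
  simpa only [mul_neg, id] using tendsto_id.atBot_mul_const (neg_pos.2 hr)

theorem stdNormalPdf_mul_galExp {α : ℝ} (hα : α ≠ 0) (r t : ℝ) :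
    stdNormalPdf (t / α - α * r) * galExp α r t = stdNormalPdf (t / α) := by
  rw [stdNormalPdf, stdNormalPdf, galExp, mul_assoc, ← Real.exp_add]
  congr 2
  field_simp
  ring

/-- GAL density in the standardized variable, with the indicators absorbed into `max (t / α) 0`. -/
noncomputable def galStdPdf (K α q r t : ℝ) : ℝ :=
  K * ((Phi (max (t / α) 0 - α * r) - Phi (-(α * r))) * galExp α r t +
    Phi (α * q - max (t / α) 0) * galExp α q t)

/-- GAL distribution function in the standardized variable, with the indicators absorbed into
`max (t / α) 0`; here `ε` is the sign of `α` and `c` the limit of the remaining terms. -/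
noncomputable def galStdCdf (K α q r ε c t : ℝ) : ℝ :=
  1 - 2 * Phi (-(ε * max (t / α) 0)) -
    K / r * galExp α r t * (Phi (max (t / α) 0 - α * r) - Phi (-(α * r))) + c -
    K / q * galExp α q t * Phi (α * q - max (t / α) 0)

theorem continuous_galStdPdf (K α q r : ℝ) : Continuous (galStdPdf K α q r) := by
  have := continuous_Phi
  have := continuous_galExp α
  unfold galStdPdf
  fun_prop

theorem continuous_galStdCdf (K α q r ε c : ℝ) : Continuous (galStdCdf K α q r ε c) := by
  have := continuous_Phi
  have := continuous_galExp α
  unfold galStdCdf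
  fun_prop

theorem galStdPdf_nonneg {K : ℝ} (hK : 0 ≤ K) (α q r t : ℝ) : 0 ≤ galStdPdf K α q r t := by
  refine mul_nonneg hK (add_nonneg (mul_nonneg (sub_nonneg.2 (monotone_Phi ?_)) (exp_pos _).le)
    (mul_nonneg (Phi_nonneg _) (exp_pos _).le))
  linarith [le_max_right (t / α) 0]

theorem hasDerivAt_galStdCdf {K α q r ε : ℝ} (c : ℝ) (hα : α ≠ 0) (hq : q ≠ 0) (hr : r ≠ 0)
    (hε : ε ^ 2 = 1) (hK : 2 * ε = K / r - K / q) (t : ℝ) :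
    HasDerivAt (galStdCdf K α q r ε c) (galStdPdf K α q r t) t := by
  refine hasDerivAt_of_hasDerivAt_of_ne' (x := 0) (fun t ht => ?_)
    (continuous_galStdCdf K α q r ε c).continuousAt
    (continuous_galStdPdf K α q r).continuousAt t
  have hcont : ContinuousAt (fun u : ℝ => u / α) t := by fun_prop
  rcases lt_or_gt_of_ne (div_ne_zero ht hα) with hs | hs
  · have hev : galStdCdf K α q r ε c =ᶠ[𝓝 t]
        fun u => c - K / q * galExp α q u * Phi (α * q) := by
      filter_upwards [hcont.eventually_lt continuousAt_const hs] with u hu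
      simp only [galStdCdf, max_eq_right hu.le, mul_zero, neg_zero, Phi_zero, zero_sub, sub_self,
        sub_zero]
      ring
    refine HasDerivAt.congr_of_eventuallyEq ?_ hev
    convert (((hasDerivAt_galExp α q t).const_mul (K / q)).mul_const (Phi (α * q))).const_sub c
      using 1
    simp only [galStdPdf, max_eq_right hs.le, zero_sub, sub_self, sub_zero]
    field_simp
    ring
  · have hev : galStdCdf K α q r ε c =ᶠ[𝓝 t] fun u =>
        1 - 2 * Phi (-(ε * (u / α))) -
          K / r * galExp α r u * (Phi (u / α - α * r) - Phi (-(α * r))) + c -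
          K / q * galExp α q u * Phi (α * q - u / α) := by
      filter_upwards [continuousAt_const.eventually_lt hcont hs] with u hu
      simp only [galStdCdf, max_eq_left hu.le]
    refine HasDerivAt.congr_of_eventuallyEq ?_ hev
    have hd : HasDerivAt (fun u : ℝ => u / α) (1 / α) t := (hasDerivAt_id t).div_const α
    have h1 : HasDerivAt (fun u => Phi (-(ε * (u / α))))
        (stdNormalPdf (-(ε * (t / α))) * -(ε * (1 / α))) t :=
      (hasDerivAt_Phi _).comp t (hd.const_mul ε).neg
    have h2 := (hasDerivAt_Phi _).comp t (hd.sub_const (α * r))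
    have h3 := (hasDerivAt_Phi _).comp t (hd.const_sub (α * q))
    have h := ((((h1.const_mul 2).const_sub 1).sub
      (((hasDerivAt_galExp α r t).const_mul (K / r)).mul
        (h2.sub_const (Phi (-(α * r)))))).add_const c).sub
      (((hasDerivAt_galExp α q t).const_mul (K / q)).mul h3)
    refine h.congr_deriv ?_
    have e1 : stdNormalPdf (-(ε * (t / α))) = stdNormalPdf (t / α) := by
      simp [stdNormalPdf, mul_pow, hε]
    have e2 := stdNormalPdf_mul_galExp hα r t
    have e3 := stdNormalPdf_mul_galExp hα q t
    rw [← stdNormalPdf_neg, neg_sub] at e3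
    simp only [galStdPdf, max_eq_left hs.le, Function.comp_apply]
    rw [e1]
    have k1 : K / r * r = K := div_mul_cancel₀ K hr
    have k2 : K / q * q = K := div_mul_cancel₀ K hq
    linear_combination (Phi (t / α - α * r) - Phi (-(α * r))) * galExp α r t * k1 +
      Phi (α * q - t / α) * galExp α q t * k2 - K / r / α * e2 + K / q / α * e3 +
      stdNormalPdf (t / α) / α * hK

theorem tendsto_galStdCdf_atBot_of_pos (K r ε : ℝ) {α q : ℝ} (hα : 0 < α) (hq : q < 0) :
    Tendsto (galStdCdf K α q r ε 0) atBot (𝓝 0) := by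
  have hev : galStdCdf K α q r ε 0 =ᶠ[atBot] fun t => -(K / q * Phi (α * q)) * galExp α q t := by
    filter_upwards [eventually_le_atBot (0 : ℝ)] with t ht
    simp only [galStdCdf, max_eq_right (div_nonpos_of_nonpos_of_nonneg ht hα.le), mul_zero,
      neg_zero, Phi_zero, zero_sub, sub_self, sub_zero]
    ring
  rw [tendsto_congr' hev]
  simpa using (tendsto_galExp_atBot α hq).const_mul (-(K / q * Phi (α * q)))

theorem tendsto_galStdCdf_atBot_of_neg (K : ℝ) {α q r : ℝ} (hα : α < 0) (hq : 0 < q)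
    (hr : r < 0) : Tendsto (galStdCdf K α q r (-1) 1) atBot (𝓝 0) := by
  have hev : galStdCdf K α q r (-1) 1 =ᶠ[atBot] fun t =>
      1 - 2 * Phi (t / α) - K / r * galExp α r t * (Phi (t / α - α * r) - Phi (-(α * r))) + 1 -
        K / q * (galExp α q t * Phi (α * q - t / α)) := by
    filter_upwards [eventually_le_atBot (0 : ℝ)] with t ht
    simp only [galStdCdf, max_eq_left (div_nonneg_of_nonpos ht hα.le), neg_mul, one_mul, neg_neg]
    ring
  have hdiv : Tendsto (fun t : ℝ => t / α) atBot atTop := by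
    simpa only [div_eq_mul_inv, id] using tendsto_id.atBot_mul_const_of_neg (inv_lt_zero.2 hα)
  have h1 := tendsto_Phi_atTop.comp hdiv
  have h2 := tendsto_Phi_atTop.comp (tendsto_atTop_add_const_right _ (-(α * r)) hdiv)
  have h3 : Tendsto (fun t => galExp α q t * Phi (α * q - t / α)) atBot (𝓝 0) := by
    have hαq : α * q < 0 := mul_neg_of_neg_of_pos hα hq
    have hlim : Tendsto (fun t : ℝ => rexp (t * q + (α * q) ^ 2 / 2)) atBot (𝓝 0) :=
      Real.tendsto_exp_atBot.comp
        (tendsto_atBot_add_const_right _ _ (tendsto_id.atBot_mul_const hq))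
    refine squeeze_zero (fun t => mul_nonneg (exp_pos _).le (Phi_nonneg _)) (fun t => ?_) hlim
    refine (mul_le_mul_of_nonneg_left (Phi_le_exp (u := 2 * (α * q)) (by linarith) _)
      (exp_pos _).le).trans_eq ?_
    rw [← Real.exp_add]
    congr 1
    field_simp [hα.ne]
    ring
  rw [tendsto_congr' hev]
  have h := ((((h1.const_mul 2).const_sub 1).sub (((tendsto_galExp_atBot α hr).const_mul
    (K / r)).mul (h2.sub_const (Phi (-(α * r)))))).add_const 1).sub (h3.const_mul (K / q))
  simpa [Function.comp_def, ← sub_eq_add_neg, show (1 : ℝ) - 2 + 1 = 0 by norm_num] using h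

theorem galPdf_eq_galStdPdf (μ σ p α v : ℝ) :
    galPdf μ σ p α v = galStdPdf (2 * p * (1 - p)) α (p - (if 0 < α then 1 else 0))
      (p - (if α < 0 then 1 else 0)) ((v - μ) / σ) * (1 / σ) := by
  simp only [galPdf, galStdPdf, galExp]
  rcases lt_or_ge 0 ((v - μ) / σ / α) with h | h
  · simp only [if_pos h, max_eq_left h.le]
    ring_nf
  · simp only [if_neg h.not_gt, max_eq_right h, zero_sub, sub_self]
    ring_nf

theorem integral_Iic_galStdPdf_comp {K α q r ε c : ℝ} (μ : ℝ) {σ : ℝ} (hσ : 0 < σ) (hK : 0 ≤ K)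
    (hα : α ≠ 0) (hq : q ≠ 0) (hr : r ≠ 0) (hε : ε ^ 2 = 1) (hKε : 2 * ε = K / r - K / q)
    (hlim : Tendsto (galStdCdf K α q r ε c) atBot (𝓝 0)) (y : ℝ) :
    ∫ v in Iic y, galStdPdf K α q r ((v - μ) / σ) * (1 / σ) =
      galStdCdf K α q r ε c ((y - μ) / σ) := by
  have hcont := continuous_galStdPdf K α q r
  rw [integral_Iic_of_hasDerivAt_of_continuous_of_nonneg (m := 0)
    (f := fun v => galStdCdf K α q r ε c ((v - μ) / σ)), sub_zero]
  · exact fun v => (hasDerivAt_galStdCdf c hα hq hr hε hKε _).comp v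
      (((hasDerivAt_id v).sub_const μ).div_const σ)
  · fun_prop
  · exact fun v => mul_nonneg (galStdPdf_nonneg hK _ _ _ _) (by positivity)
  · exact hlim.comp ((tendsto_atBot_add_const_right _ (-μ) tendsto_id).atBot_div_const hσ)

/-- The cumulative distribution function of the GAL distribution. -/
theorem gal_cdf (μ σ p α : ℝ) (hσ : 0 < σ) (hp : p ∈ Set.Ioo (0 : ℝ) 1)
    (hα : α ≠ 0) (y : ℝ) :
    (∫ v in Set.Iic y, galPdf μ σ p α v) =
      (let ys := (y - μ) / σ
       let pp := p - (if 0 < α then 1 else 0)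
       let pm := p - (if α < 0 then 1 else 0)
       (1 - 2 * Phi (-(ys / |α|)) -
            (2 * p * (1 - p) / pm) *
              Real.exp (-(ys * pm) + α ^ 2 * pm ^ 2 / 2) *
              (Phi (ys / α - α * pm) - Phi (-(α * pm)))) *
          (if 0 < ys / α then 1 else 0) +
        (if α < 0 then 1 else 0) -
        (2 * p * (1 - p) / pp) *
          Real.exp (-(ys * pp) + α ^ 2 * pp ^ 2 / 2) *
          Phi (α * pp - ys / α * (if 0 < ys / α then 1 else 0))) := by
  have hK : 0 ≤ 2 * p * (1 - p) := by nlinarith [hp.1, hp.2]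
  have hp0 : p ≠ 0 := hp.1.ne'
  have hp1 : p - 1 < 0 := by linarith [hp.2]
  simp only [galPdf_eq_galStdPdf]
  rcases lt_or_gt_of_ne hα with h | h
  · simp only [if_neg h.not_gt, if_pos h, sub_zero, abs_of_neg h]
    rw [integral_Iic_galStdPdf_comp μ hσ hK hα hp0 hp1.ne (ε := -1) (by norm_num)
      (by field_simp [hp1.ne]; ring) (tendsto_galStdCdf_atBot_of_neg _ h hp.1 hp1)]
    simp only [galStdCdf, galExp]
    rcases lt_or_ge 0 ((y - μ) / σ / α) with hs | hs
    · simp only [if_pos hs, max_eq_left hs.le, div_neg, neg_mul, one_mul, mul_one, mul_pow]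
    · simp only [if_neg hs.not_gt, max_eq_right hs, mul_zero, neg_zero, Phi_zero, zero_sub,
        sub_self, sub_zero, mul_pow]
      ring
  · simp only [if_neg h.not_gt, if_pos h, sub_zero, abs_of_pos h]
    rw [integral_Iic_galStdPdf_comp μ hσ hK hα hp1.ne hp0 (ε := 1) (by norm_num)
      (by field_simp [hp1.ne]; ring) (tendsto_galStdCdf_atBot_of_pos _ _ _ h hp1)]
    simp only [galStdCdf, galExp]
    rcases lt_or_ge 0 ((y - μ) / σ / α) with hs | hs
    · simp only [if_pos hs, max_eq_left hs.le, one_mul, mul_one, mul_pow]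
    · simp only [if_neg hs.not_gt, max_eq_right hs, mul_zero, neg_zero, Phi_zero, zero_sub,
        sub_self, sub_zero, mul_pow]
      ring
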